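/- arXiv:1311.5945 — 2 statements merged into one kernel-verified Lean document; each statement's English description precedes it below -/
import Mathlib

section
/- Let $A \subseteq \{0,1\}^n$ be monotone, let $B \subseteq A$ be a nonempty set with $\mathbb{P}(B) \le \mathbb{P}(A)/2$, and set $C = A \setminus B$. Then at least one of the following holds: (i) for every monotone set $F \subseteq \{0,1\}^n$, $\mathbb{P}(B \oplus F) \ge \mathbb{P}(A)\mathbb{P}(B)/16$; or (ii) for every monotone set $F \subseteq \{0,1\}^n$, $\mathbb{P}(C \oplus F) \ge \mathbb{P}(A)\mathbb{P}(B)/16$. -/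
/-- A set `A ⊆ {0,1}^n` is monotone if `x ∈ A` and `x ≤ y` (coordinatewise)
imply `y ∈ A`. -/
def IsMonotoneSet {n : ℕ} (A : Finset (Fin n → Bool)) : Prop :=
  ∀ x ∈ A, ∀ y : Fin n → Bool, (∀ i, x i ≤ y i) → y ∈ A

theorem harris_card {n : ℕ} (F G : Finset (Fin n → Bool))
    (hF : IsMonotoneSet F) (hG : IsMonotoneSet G) :
    (F.card : ℝ) * G.card ≤ 2 ^ n * (F ∩ G).card := by
  have key : ∀ H : Finset (Fin n → Bool), IsMonotoneSet H →
      Monotone (fun x => if x ∈ H then (1 : ℝ) else 0) := by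
    intro H hH x y hxy
    by_cases hx : x ∈ H
    · have hy : y ∈ H := hH x hx y hxy
      simp [hx, hy]
    · by_cases hy : y ∈ H <;> simp [hx, hy]
  have h := fkg (μ := fun _ : Fin n → Bool => (1 : ℝ))
    (f := fun x => if x ∈ F then (1 : ℝ) else 0)
    (g := fun x => if x ∈ G then (1 : ℝ) else 0)
    (fun _ => zero_le_one)
    (fun x => by dsimp; split_ifs <;> norm_num)
    (fun x => by dsimp; split_ifs <;> norm_num)
    (key F hF) (key G hG) (fun _ _ => le_rfl)
  have e : ∀ x : Fin n → Bool, (if x ∈ F then (1 : ℝ) else 0) * (if x ∈ G then (1 : ℝ) else 0)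
      = if x ∈ F ∩ G then 1 else 0 := by
    intro x
    by_cases h1 : x ∈ F <;> by_cases h2 : x ∈ G <;> simp [h1, h2]
  simp only [e, one_mul] at h
  simpa only [Finset.sum_boole, Finset.filter_univ_mem, Finset.sum_const, Finset.card_univ,
    Fintype.card_fun, Fintype.card_bool, Fintype.card_fin, nsmul_eq_mul, mul_one,
    Nat.cast_pow, Nat.cast_ofNat] using h

theorem card_le_symmDiff {n : ℕ} (B F : Finset (Fin n → Bool)) :
    (B.card : ℝ) ≤ F.card + (symmDiff B F).card := by
  have h : B ⊆ F ∪ symmDiff B F := by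
    intro x hx
    simp only [Finset.mem_union, Finset.mem_symmDiff]
    tauto
  exact_mod_cast (Finset.card_le_card h).trans (Finset.card_union_le _ _)

/-- For a monotone `A ⊆ {0,1}^n`, a nonempty `B ⊆ A` with `ℙ(B) ≤ ℙ(A)/2`,
and `C = A \ B`: either every monotone `F` has `ℙ(B ⊕ F) ≥ ℙ(A)ℙ(B)/16`, or
every monotone `F` has `ℙ(C ⊕ F) ≥ ℙ(A)ℙ(B)/16`. -/
theorem far_from_monotone_dichotomy {n : ℕ} (A B : Finset (Fin n → Bool))
    (hmono : IsMonotoneSet A) (hBA : B ⊆ A) (hB : B.Nonempty)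
    (hhalf : (B.card : ℝ) / 2 ^ n ≤ ((A.card : ℝ) / 2 ^ n) / 2) :
    (∀ F : Finset (Fin n → Bool), IsMonotoneSet F →
        ((symmDiff B F).card : ℝ) / 2 ^ n
          ≥ ((A.card : ℝ) / 2 ^ n) * ((B.card : ℝ) / 2 ^ n) / 16) ∨
    (∀ F : Finset (Fin n → Bool), IsMonotoneSet F →
        ((symmDiff (A \ B) F).card : ℝ) / 2 ^ n
          ≥ ((A.card : ℝ) / 2 ^ n) * ((B.card : ℝ) / 2 ^ n) / 16) := by
  by_contra hcon
  push Not at hcon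
  obtain ⟨⟨F, hF, h1⟩, G, hG, h2⟩ := hcon
  have hfkg := harris_card F G hF hG
  have hBF := card_le_symmDiff B F
  have hCG := card_le_symmDiff (A \ B) G
  have hFG : ((F ∩ G).card : ℝ) ≤ (symmDiff B F).card + (symmDiff (A \ B) G).card := by
    have h : F ∩ G ⊆ symmDiff B F ∪ symmDiff (A \ B) G := by
      intro x hx
      simp only [Finset.mem_union, Finset.mem_symmDiff, Finset.mem_inter, Finset.mem_sdiff] at *
      tauto
    exact_mod_cast (Finset.card_le_card h).trans (Finset.card_union_le _ _)
  have hC : ((A \ B).card : ℝ) + B.card = A.card := by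
    exact_mod_cast Finset.card_sdiff_add_card_eq_card hBA
  have hA1 : (A.card : ℝ) ≤ 2 ^ n := by
    have := Finset.card_le_univ A
    simp only [Fintype.card_fun, Fintype.card_bool, Fintype.card_fin] at this
    exact_mod_cast this
  have hB0 : (0 : ℝ) < B.card := by exact_mod_cast hB.card_pos
  have hN : (0 : ℝ) < 2 ^ n := by positivity
  generalize (2 : ℝ) ^ n = N at *
  generalize ((symmDiff B F).card : ℝ) = d at *
  generalize ((symmDiff (A \ B) G).card : ℝ) = e at *
  generalize ((F ∩ G).card : ℝ) = i at *
  generalize ((A \ B).card : ℝ) = c at *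
  generalize (F.card : ℝ) = f at *
  generalize (G.card : ℝ) = g at *
  generalize (A.card : ℝ) = a at *
  generalize (B.card : ℝ) = b at *
  have hba : b ≤ a / 2 := by
    rw [div_right_comm] at hhalf
    exact (div_le_div_iff_of_pos_right hN).1 hhalf
  have e0 : a / N * (b / N) / 16 = (a * b / N / 16) / N := by field_simp
  rw [e0] at h1 h2
  have h1 := (div_lt_div_iff_of_pos_right hN).1 h1
  have h2 := (div_lt_div_iff_of_pos_right hN).1 h2
  have hN' : N * (a * b / N / 16) = a * b / 16 := by field_simp
  have hab : a * b / N ≤ b := by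
    rw [div_le_iff₀ hN]
    nlinarith
  have hf : 15 / 16 * b ≤ f := by linarith
  have hg : 7 / 16 * a ≤ g := by linarith
  have ha0 : 0 < a := by linarith
  have hprod : (15 / 16 * b) * (7 / 16 * a) ≤ f * g :=
    mul_le_mul hf hg (by positivity) (by linarith)
  have hi : N * i ≤ N * (2 * (a * b / N / 16)) :=
    mul_le_mul_of_nonneg_left (by linarith) hN.le
  have : 0 < a * b := by positivity
  nlinarith
end

section
/- Let $A \subseteq \{0,1\}^n$ be a nonempty monotone set and let $P$ be the transition matrix on $A$ of the censored Glauber chain $M_A$. Then for every integer $t \ge 2\left(\frac{16 n}{\mathbb{P}[A]}\right)^2 \log\!\big(4 \cdot 2^n\, \mathbb{P}[A]\big)$ and every starting state $x_0 \in A$, the total variation distance to stationarity satisfies $\frac{1}{2} \sum_{y \in A} \left| P^t(x_0, y) - \frac{1}{|A|} \right| \le \frac{1}{4}$. In particular, the mixing time of $M_A$ is at most $2\,(16n/\mathbb{P}[A])^2 \log(4 \cdot 2^n\,\mathbb{P}[A])$. -/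
/-- Two vertices of the hypercube `{0,1}^n` are adjacent iff they differ
in exactly one coordinate. -/
abbrev adjacent {n : ℕ} (x y : Fin n → Bool) : Prop :=
  (Finset.univ.filter fun i => x i ≠ y i).card = 1

/-- The transition matrix on `A` of the censored Glauber chain `M_A`:
`P(x,y) = 1/(2n)` for distinct adjacent `x, y ∈ A`,
`P(x,x) = 1 - |{y ∈ A : y ≠ x, y adjacent to x}|/(2n)`, and `0` otherwise. -/
noncomputable def censoredPmat (n : ℕ) (A : Finset (Fin n → Bool)) :
    Matrix {x // x ∈ A} {x // x ∈ A} ℝ :=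
  fun x y =>
    if (x : Fin n → Bool) = y then
      1 - ((A.filter fun z => z ≠ (x : Fin n → Bool) ∧ adjacent (x : Fin n → Bool) z).card : ℝ) / (2 * n)
    else if adjacent (x : Fin n → Bool) (y : Fin n → Bool) then 1 / (2 * n)
    else 0


namespace Censored

open Finset

/-- Two-point exchange inequality on the cube, summed over all coordinates. -/
theorem exchange (n : ℕ) : ∀ (Φ : (Fin n → Bool) → (Fin n → Bool) → ℝ)
    (G H : (Fin n → Bool) → Fin n → ℝ)
    (_ : ∀ x y k, Φ (Function.update x k false) (Function.update y k true)
        + Φ (Function.update x k true) (Function.update y k false)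
        - Φ (Function.update x k false) (Function.update y k false)
        - Φ (Function.update x k true) (Function.update y k true) ≤ G x k + H y k),
    ∑ x, ∑ y, Φ x y ≤ 2 ^ n * ∑ x, Φ x x + 2 ^ n / 4 * ∑ x, ∑ k, (G x k + H x k) := by
  induction n with
  | zero =>
    intro Φ G H _
    simp
  | succ n ih =>
    intro Φ G H hyp
    have key : ∀ f : (Fin (n+1) → Bool) → ℝ,
        ∑ x, f x = ∑ x : Fin n → Bool, f (Fin.cons false x) + ∑ x : Fin n → Bool, f (Fin.cons true x) := by
      intro f
      rw [← (Fin.consEquiv (fun _ : Fin (n+1) => Bool)).sum_comp, Fintype.sum_prod_type]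
      simp [Fin.consEquiv, add_comm]
    have ihab : ∀ a b : Bool, ∑ x : Fin n → Bool, ∑ y : Fin n → Bool, Φ (Fin.cons a x) (Fin.cons b y)
        ≤ 2 ^ n * ∑ x : Fin n → Bool, Φ (Fin.cons a x) (Fin.cons b x)
          + 2 ^ n / 4 * ∑ x : Fin n → Bool, ∑ k : Fin n,
              (G (Fin.cons a x) k.succ + H (Fin.cons b x) k.succ) := by
      intro a b
      apply ih (fun x y => Φ (Fin.cons a x) (Fin.cons b y))
        (fun x k => G (Fin.cons a x) k.succ) (fun x k => H (Fin.cons b x) k.succ)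
      intro x y k
      have := hyp (Fin.cons a x) (Fin.cons b y) k.succ
      simpa only [← Fin.cons_update] using this
    have h0 : ∀ (x : Fin n → Bool) (a : Bool), 
        Φ (Fin.cons false x) (Fin.cons true x) + Φ (Fin.cons true x) (Fin.cons false x)
        - Φ (Fin.cons false x) (Fin.cons false x) - Φ (Fin.cons true x) (Fin.cons true x)
        ≤ G (Fin.cons a x) 0 + H (Fin.cons a x) 0 := by
      intro x a
      have := hyp (Fin.cons a x) (Fin.cons a x) 0
      simpa only [Fin.update_cons_zero] using this
    have h1 : ∀ a : Bool, ∑ x : Fin n → Bool, Φ (Fin.cons false x) (Fin.cons true x)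
        + ∑ x : Fin n → Bool, Φ (Fin.cons true x) (Fin.cons false x)
        - ∑ x : Fin n → Bool, Φ (Fin.cons false x) (Fin.cons false x)
        - ∑ x : Fin n → Bool, Φ (Fin.cons true x) (Fin.cons true x)
        ≤ ∑ x : Fin n → Bool, G (Fin.cons a x) 0 + ∑ x : Fin n → Bool, H (Fin.cons a x) 0 := by
      intro a
      rw [← sum_add_distrib, ← sum_sub_distrib, ← sum_sub_distrib, ← sum_add_distrib]
      exact sum_le_sum fun x _ => h0 x a
    have e1 := ihab false false
    have e2 := ihab false true
    have e3 := ihab true false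
    have e4 := ihab true true
    have f1 := h1 false
    have f2 := h1 true
    simp only [key, Fin.sum_univ_succ, sum_add_distrib] at *
    have hp : (0:ℝ) < 2 ^ n := by positivity
    have g := mul_le_mul_of_nonneg_left (add_le_add f1 f2) hp.le
    rw [pow_succ]
    nlinarith

/-- Flip one coordinate. -/
def fl {n : ℕ} (x : Fin n → Bool) (k : Fin n) : Fin n → Bool := Function.update x k (!x k)

theorem fl_fl {n : ℕ} (x : Fin n → Bool) (k : Fin n) : fl (fl x k) k = x := by
  simp [fl]

theorem sum_fl {n : ℕ} (f : (Fin n → Bool) → ℝ) (k : Fin n) : ∑ x, f (fl x k) = ∑ x, f x := by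
  have hi : Function.Involutive (fun x : Fin n → Bool => fl x k) := fun x => fl_fl x k
  exact Equiv.sum_comp hi.toPerm f

/-- censored difference -/
noncomputable def q {n : ℕ} (A : Finset (Fin n → Bool)) (h : (Fin n → Bool) → ℝ)
    (x : Fin n → Bool) (k : Fin n) : ℝ :=
  if x ∈ A ∧ fl x k ∈ A then h x - h (fl x k) else 0

theorem q_fl {n : ℕ} (A : Finset (Fin n → Bool)) (h : (Fin n → Bool) → ℝ)
    (x : Fin n → Bool) (k : Fin n) : q A h (fl x k) k = - q A h x k := by
  unfold q
  rw [fl_fl]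
  by_cases h1 : x ∈ A <;> by_cases h2 : fl x k ∈ A <;> simp [h1, h2]

theorem sum_q {n : ℕ} (A : Finset (Fin n → Bool)) (h : (Fin n → Bool) → ℝ) :
    ∑ x, ∑ k, q A h x k = 0 := by
  rw [sum_comm]
  apply sum_eq_zero
  intro k _
  have := sum_fl (fun x => q A h x k) k
  simp only [q_fl, sum_neg_distrib] at this
  linarith

theorem sum_hq {n : ℕ} (A : Finset (Fin n → Bool)) (h : (Fin n → Bool) → ℝ) :
    2 * ∑ x, h x * ∑ k, q A h x k = ∑ x, ∑ k, q A h x k ^ 2 := by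
  simp only [mul_sum]
  rw [sum_comm, sum_comm (f := fun x k => q A h x k ^ 2)]
  apply sum_congr rfl
  intro k _
  have h1 := sum_fl (fun x => h x * q A h x k) k
  simp only [q_fl] at h1
  rw [← mul_sum, two_mul]
  nth_rewrite 2 [← h1]
  rw [← sum_add_distrib]
  apply sum_congr rfl
  intro x _
  unfold q
  split_ifs <;> ring

theorem l1 {n : ℕ} (A : Finset (Fin n → Bool)) (hmono : IsMonotoneSet A)
    (F : (Fin n → Bool) → ℝ) :
    ∑ x ∈ A, ∑ y ∈ A, |F x - F y| ≤ 2 ^ n / 2 * ∑ x, ∑ k, |q A F x k| := by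
  have h := exchange n (fun x y => if x ∈ A then (if y ∈ A then |F x - F y| else 0) else 0)
    (fun x k => |q A F x k|) (fun x k => |q A F x k|) ?_
  · simp only [sub_self, abs_zero, ite_self, sum_const_zero, mul_zero, zero_add, ← two_mul] at h
    simp only [← mul_sum] at h
    have e : ∑ x ∈ A, ∑ y ∈ A, |F x - F y| = ∑ x, ∑ y, (if x ∈ A then (if y ∈ A then |F x - F y| else 0) else 0) := by
      simp [← sum_filter, sum_ite_irrel]
    rw [e]
    linarith
  · have hq : ∀ x k, |q A F x k| = if Function.update x k false ∈ A ∧ Function.update x k true ∈ A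
        then |F (Function.update x k false) - F (Function.update x k true)| else 0 := by
      intro x k
      have hx : x = Function.update x k (x k) := by simp
      unfold q fl
      cases hk : x k
      · rw [hk] at hx
        simp only [Bool.not_false]
        rw [← hx]
        split_ifs <;> simp
      · rw [hk] at hx
        simp only [Bool.not_true]
        rw [← hx, abs_sub_comm]
        by_cases h1 : x ∈ A <;> by_cases h2 : Function.update x k false ∈ A <;> simp [h1, h2, abs_sub_comm]
    intro x y k
    have hm : ∀ x : Fin n → Bool, Function.update x k false ∈ A → Function.update x k true ∈ A := by
      intro x hx
      apply hmono _ hx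
      intro i
      by_cases hi : i = k
      · subst hi; simp
      · simp [hi]
    simp only [hq]
    have hx := hm x
    have hy := hm y
    generalize Function.update x k false = x0 at *
    generalize Function.update x k true = x1 at *
    generalize Function.update y k false = y0 at *
    generalize Function.update y k true = y1 at *
    have t1 : ∀ a b c : ℝ, |a - c| ≤ |a - b| + |b - c| := abs_sub_le
    have t2 : ∀ a b : ℝ, |a - b| = |b - a| := abs_sub_comm
    have t3 : ∀ a b : ℝ, 0 ≤ |a - b| := fun a b => abs_nonneg _
    by_cases a0 : x0 ∈ A <;> by_cases a1 : x1 ∈ A <;> by_cases b0 : y0 ∈ A <;> by_cases b1 : y1 ∈ A <;>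
      simp only [a0, a1, b0, b1, if_true, if_false, and_self, and_true, and_false, false_and, true_and, imp_false, not_true, true_imp_iff, not_false_iff, IsEmpty.forall_iff] at hx hy ⊢
    all_goals
      try linarith [t1 (F x0) (F x1) (F y1), t1 (F x0) (F y0) (F y1), t1 (F x1) (F x0) (F y0), t1 (F x1) (F y1) (F y0), t2 (F x0) (F x1), t2 (F y0) (F y1), t3 (F x0) (F x1), t3 (F y0) (F y1), t3 (F x0) (F y0), t3 (F x1) (F y1)]

theorem exists_center {α : Type*} (A : Finset α) (hA : A.Nonempty) (h : α → ℝ) :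
    ∃ c : ℝ, ∑ x ∈ A, (h x - c) * |h x - c| = 0 := by
  have hc : Continuous (fun c : ℝ => ∑ x ∈ A, (h x - c) * |h x - c|) := by fun_prop
  obtain ⟨a, ha, hamin⟩ := A.exists_min_image h hA
  obtain ⟨b, hb, hbmax⟩ := A.exists_max_image h hA
  have h1 : 0 ≤ ∑ x ∈ A, (h x - h a) * |h x - h a| :=
    sum_nonneg fun x hx => mul_nonneg (sub_nonneg.2 (hamin x hx)) (abs_nonneg _)
  have h2 : ∑ x ∈ A, (h x - h b) * |h x - h b| ≤ 0 :=
    sum_nonpos fun x hx => mul_nonpos_of_nonpos_of_nonneg (sub_nonpos.2 (hbmax x hx)) (abs_nonneg _)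
  have := mem_range_of_exists_le_of_exists_ge hc ⟨h b, h2⟩ ⟨h a, h1⟩
  exact this

theorem abs_diff (u v : ℝ) : |(u * |u|) - (v * |v|)| ≤ |u - v| * (|u| + |v|) := by
  rcases abs_cases u with ⟨hu, h1⟩ | ⟨hu, h1⟩ <;> rcases abs_cases v with ⟨hv, h2⟩ | ⟨hv, h2⟩ <;>
    rw [hu, hv, abs_le] <;>
    rcases abs_cases (u - v) with ⟨hw, h3⟩ | ⟨hw, h3⟩ <;> rw [hw] <;> constructor <;> nlinarith [sq_nonneg u, sq_nonneg v, mul_nonneg_of_nonpos_of_nonpos (a := min u 0) (b := min v 0) (by simp) (by simp)]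

theorem poincare {n : ℕ} (A : Finset (Fin n → Bool)) (hA : A.Nonempty) (hmono : IsMonotoneSet A)
    (h : (Fin n → Bool) → ℝ) (h0 : ∑ x ∈ A, h x = 0) :
    ((A.card : ℝ) / 2 ^ n) ^ 2 * ∑ x ∈ A, h x ^ 2 ≤ n * ∑ x, ∑ k, q A h x k ^ 2 := by
  obtain ⟨c, hc⟩ := exists_center A hA h
  set u : (Fin n → Bool) → ℝ := fun x => h x - c with hu
  set F : (Fin n → Bool) → ℝ := fun x => u x * |u x| with hF
  set V := ∑ x ∈ A, u x ^ 2 with hV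
  set Q := ∑ x, ∑ k, q A h x k ^ 2 with hQ
  have hQ0 : 0 ≤ Q := by positivity
  have hV0 : 0 ≤ V := by positivity
  have hcard : (0:ℝ) < A.card := by exact_mod_cast hA.card_pos
  have hVh : ∑ x ∈ A, h x ^ 2 ≤ V := by
    have : V = ∑ x ∈ A, h x ^ 2 - 2 * c * ∑ x ∈ A, h x + A.card * c ^ 2 := by
      rw [hV, mul_sum, ← sum_sub_distrib, ← nsmul_eq_mul, ← sum_const, ← sum_add_distrib]
      apply sum_congr rfl
      intro x _
      simp only [hu]; ring
    rw [this, h0]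
    have : 0 ≤ A.card * c ^ 2 := by positivity
    linarith
  have s1 : A.card * V ≤ ∑ x ∈ A, ∑ y ∈ A, |F x - F y| := by
    rw [hV, mul_sum]
    apply sum_le_sum
    intro x _
    have e : ∑ y ∈ A, (F x - F y) = A.card * F x := by
      rw [sum_sub_distrib, sum_const, nsmul_eq_mul]
      have : ∑ y ∈ A, F y = 0 := hc
      rw [this, sub_zero]
    calc (A.card : ℝ) * u x ^ 2 = |A.card * F x| := by
          simp only [hF, abs_mul, abs_abs, Nat.abs_cast]
          rw [← sq, sq_abs]
      _ = |∑ y ∈ A, (F x - F y)| := by rw [e]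
      _ ≤ _ := abs_sum_le_sum_abs _ _
  have s2 := l1 A hmono F
  let w : (Fin n → Bool) → Fin n → ℝ := fun x k => if x ∈ A ∧ fl x k ∈ A then |u x| + |u (fl x k)| else 0
  have s3 : ∑ x, ∑ k, |q A F x k| ≤ ∑ x, ∑ k, |q A h x k| * w x k := by
    apply sum_le_sum; intro x _
    apply sum_le_sum; intro k _
    simp only [q, w]
    split_ifs
    · have := abs_diff (u x) (u (fl x k))
      have e : u x - u (fl x k) = h x - h (fl x k) := by simp [hu]
      rw [e] at this
      exact this
    · simp
  have s4 : (∑ x, ∑ k, |q A h x k| * w x k) ^ 2 ≤ Q * ∑ x, ∑ k, w x k ^ 2 := by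
    have := sum_mul_sq_le_sq_mul_sq (univ : Finset ((Fin n → Bool) × Fin n))
      (fun p => |q A h p.1 p.2|) (fun p => w p.1 p.2)
    simpa only [Fintype.sum_prod_type, sq_abs] using this
  have s5 : ∑ x, ∑ k, w x k ^ 2 ≤ 4 * n * V := by
    let v : (Fin n → Bool) → ℝ := fun x => if x ∈ A then u x ^ 2 else 0
    have hv : ∑ x, v x = V := by simp [v, hV, ← sum_filter]
    have hw : ∀ x k, w x k ^ 2 ≤ 2 * v x + 2 * v (fl x k) := by
      intro x k
      simp only [w, v]
      by_cases h1 : x ∈ A <;> by_cases h2 : fl x k ∈ A <;> simp [h1, h2]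
      · nlinarith [sq_abs (u x), sq_abs (u (fl x k)), sq_nonneg (|u x| - |u (fl x k)|)]
      all_goals positivity
    calc ∑ x, ∑ k, w x k ^ 2 ≤ ∑ x, ∑ k, (2 * v x + 2 * v (fl x k)) :=
          sum_le_sum fun x _ => sum_le_sum fun k _ => hw x k
      _ = ∑ k : Fin n, 4 * V := by
          rw [sum_comm]
          apply sum_congr rfl
          intro k _
          rw [sum_add_distrib, ← mul_sum, ← mul_sum, sum_fl, hv]
          ring
      _ = _ := by simp; ring
  have hp : (0:ℝ) < 2 ^ n := by positivity
  set T := ∑ x, ∑ k, |q A h x k| * w x k with hT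
  have s6 : A.card * V ≤ 2 ^ n / 2 * T :=
    s1.trans (s2.trans (mul_le_mul_of_nonneg_left s3 (by positivity)))
  have s7 : (A.card * V) ^ 2 ≤ (2 ^ n / 2 * T) ^ 2 := pow_le_pow_left₀ (by positivity) s6 2
  have s8 : T ^ 2 ≤ Q * (4 * n * V) := s4.trans (mul_le_mul_of_nonneg_left s5 hQ0)
  have s9 : V * ((A.card : ℝ) ^ 2 * V) ≤ V * ((2 ^ n) ^ 2 * (n * Q)) := by
    have := mul_le_mul_of_nonneg_left s8 (show (0:ℝ) ≤ (2 ^ n) ^ 2 / 4 by positivity)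
    nlinarith
  have s10 : (A.card : ℝ) ^ 2 * V ≤ (2 ^ n) ^ 2 * (n * Q) := by
    rcases hV0.eq_or_lt with h | h
    · rw [← h, mul_zero]; positivity
    · exact le_of_mul_le_mul_left s9 h
  calc ((A.card : ℝ) / 2 ^ n) ^ 2 * ∑ x ∈ A, h x ^ 2 ≤ ((A.card : ℝ) / 2 ^ n) ^ 2 * V :=
        mul_le_mul_of_nonneg_left hVh (by positivity)
    _ = (A.card : ℝ) ^ 2 * V / (2 ^ n) ^ 2 := by field_simp
    _ ≤ _ := by rw [div_le_iff₀ (by positivity)]; linarith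

/-- one step of the chain on functions -/
noncomputable def stp {n : ℕ} (A : Finset (Fin n → Bool)) (h : (Fin n → Bool) → ℝ)
    (x : Fin n → Bool) : ℝ := h x - 1 / (2 * n) * ∑ k, q A h x k

theorem stp_sum {n : ℕ} (A : Finset (Fin n → Bool)) (h : (Fin n → Bool) → ℝ) :
    ∑ x, stp A h x = ∑ x, h x := by
  simp only [stp, sum_sub_distrib, ← mul_sum, sum_q]; simp

theorem stp_sq {n : ℕ} (hn : 0 < n) (A : Finset (Fin n → Bool)) (h : (Fin n → Bool) → ℝ) :
    ∑ x, stp A h x ^ 2 ≤ ∑ x, h x ^ 2 - 1 / (4 * n) * ∑ x, ∑ k, q A h x k ^ 2 := by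
  have hn' : (0:ℝ) < n := by exact_mod_cast hn
  have e : ∑ x, stp A h x ^ 2 = ∑ x, h x ^ 2 - 1 / n * ∑ x, h x * ∑ k, q A h x k
      + 1 / (4 * n ^ 2) * ∑ x, (∑ k, q A h x k) ^ 2 := by
    rw [mul_sum, mul_sum, ← sum_sub_distrib, ← sum_add_distrib]
    apply sum_congr rfl
    intro x _
    simp only [stp]
    field_simp
    ring
  have h1 := sum_hq A h
  have h2 : ∑ x, (∑ k, q A h x k) ^ 2 ≤ n * ∑ x, ∑ k, q A h x k ^ 2 := by
    rw [mul_sum]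
    apply sum_le_sum
    intro x _
    have := sq_sum_le_card_mul_sum_sq (s := (univ : Finset (Fin n))) (f := fun k => q A h x k)
    simpa using this
  rw [e]
  have h3 := mul_le_mul_of_nonneg_left h2 (show (0:ℝ) ≤ 1 / (4 * n ^ 2) by positivity)
  have h4 : 1 / (4 * (n:ℝ) ^ 2) * (n * ∑ x, ∑ k, q A h x k ^ 2) = 1 / (4 * n) * ∑ x, ∑ k, q A h x k ^ 2 := by
    field_simp
  have h5 : 1 / (n:ℝ) * ∑ x, h x * ∑ k, q A h x k = 2 * (1 / (4 * n) * ∑ x, ∑ k, q A h x k ^ 2) := by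
    rw [← h1]; field_simp; norm_num
  linarith

theorem stp_contract {n : ℕ} (hn : 0 < n) (A : Finset (Fin n → Bool)) (hA : A.Nonempty)
    (hmono : IsMonotoneSet A) (h : (Fin n → Bool) → ℝ) (hs : ∀ x, x ∉ A → h x = 0)
    (h0 : ∑ x, h x = 0) :
    ∑ x, stp A h x ^ 2 ≤ (1 - ((A.card : ℝ) / 2 ^ n) ^ 2 / (4 * n ^ 2)) * ∑ x, h x ^ 2 := by
  have hn' : (0:ℝ) < n := by exact_mod_cast hn
  have e1 : ∑ x ∈ A, h x = ∑ x, h x := sum_subset (subset_univ _) fun x _ hx => hs x hx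
  have e2 : ∑ x ∈ A, h x ^ 2 = ∑ x, h x ^ 2 :=
    sum_subset (subset_univ _) fun x _ hx => by rw [hs x hx]; norm_num
  have h1 := poincare A hA hmono h (e1.trans h0)
  have h2 := stp_sq hn A h
  rw [e2] at h1
  have h3 := mul_le_mul_of_nonneg_left h1 (show (0:ℝ) ≤ 1 / (4 * n ^ 2) by positivity)
  have h4 : 1 / (4 * (n:ℝ) ^ 2) * (n * ∑ x, ∑ k, q A h x k ^ 2) = 1 / (4 * n) * ∑ x, ∑ k, q A h x k ^ 2 := by
    field_simp
  rw [h4] at h3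
  have h5 : 1 / (4 * (n:ℝ) ^ 2) * (((A.card : ℝ) / 2 ^ n) ^ 2 * ∑ x, h x ^ 2) =
    ((A.card : ℝ) / 2 ^ n) ^ 2 / (4 * n ^ 2) * ∑ x, h x ^ 2 := by ring
  linarith

theorem stp_supp {n : ℕ} (A : Finset (Fin n → Bool)) (h : (Fin n → Bool) → ℝ)
    (hs : ∀ x, x ∉ A → h x = 0) (x : Fin n → Bool) (hx : x ∉ A) : stp A h x = 0 := by
  simp [stp, q, hx, hs]

theorem adjacent_iff {n : ℕ} (x y : Fin n → Bool) : adjacent x y ↔ ∃ k, y = fl x k := by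
  unfold adjacent
  rw [card_eq_one]
  constructor
  · rintro ⟨k, hk⟩
    refine ⟨k, ?_⟩
    have hk' : ∀ i, x i ≠ y i ↔ i = k := by
      intro i
      have := congrArg (fun s => i ∈ s) hk
      simpa using this
    ext i
    by_cases hi : i = k
    · subst hi
      have := (hk' i).2 rfl
      simp only [fl, Function.update_self]
      cases h1 : x i <;> cases h2 : y i <;> simp_all
    · have := (not_congr (hk' i)).2 hi
      simp only [fl, Function.update_of_ne hi]
      exact (not_not.1 this).symm
  · rintro ⟨k, rfl⟩
    refine ⟨k, ?_⟩
    ext i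
    by_cases hi : i = k
    · subst hi; rw [mem_filter]; simp [fl]
    · rw [mem_filter]; simp [fl, hi]

theorem fl_ne {n : ℕ} (x : Fin n → Bool) (k : Fin n) : fl x k ≠ x := by
  intro h
  have := congrFun h k
  simp [fl] at this

theorem fl_inj {n : ℕ} (x : Fin n → Bool) : Function.Injective (fl x) := by
  intro k l h
  by_contra hkl
  have := congrFun h k
  simp [fl, Function.update_of_ne hkl] at this

theorem sum_nbr {n : ℕ} (A : Finset (Fin n → Bool)) (x : Fin n → Bool) (g : (Fin n → Bool) → ℝ) :
    ∑ z ∈ A.filter (fun z => z ≠ x ∧ adjacent x z), g z = ∑ k, if fl x k ∈ A then g (fl x k) else 0 := by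
  have : A.filter (fun z => z ≠ x ∧ adjacent x z)
      = (univ.filter (fun k => fl x k ∈ A)).image (fl x) := by
    ext z
    simp only [mem_filter, mem_image, mem_univ, true_and, adjacent_iff]
    constructor
    · rintro ⟨h1, h2, k, rfl⟩
      exact ⟨k, h1, rfl⟩
    · rintro ⟨k, h1, rfl⟩
      exact ⟨h1, fl_ne x k, k, rfl⟩
  rw [this, sum_image ((fl_inj x).injOn), sum_filter]

theorem P_symm {n : ℕ} (A : Finset (Fin n → Bool)) (x y : {x // x ∈ A}) :
    censoredPmat n A x y = censoredPmat n A y x := by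
  have ha : adjacent (x : Fin n → Bool) y ↔ adjacent (y : Fin n → Bool) x := by
    simp only [adjacent, ne_comm]
  unfold censoredPmat
  by_cases h : (x : Fin n → Bool) = y
  · rw [Subtype.ext h]
  · rw [if_neg h, if_neg (Ne.symm h)]
    simp only [ha]

theorem P_mul {n : ℕ} (A : Finset (Fin n → Bool)) (h : (Fin n → Bool) → ℝ) (y : {x // x ∈ A}) :
    ∑ z : {x // x ∈ A}, censoredPmat n A y z * h z = stp A h y := by
  have e : ∀ z : {x // x ∈ A}, censoredPmat n A y z * h z =
      (fun z : Fin n → Bool => (if z = y then (1 - ((A.filter fun z => z ≠ (y : Fin n → Bool) ∧ adjacent (y : Fin n → Bool) z).card : ℝ) / (2 * n)) * h y else 0)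
      + (if z ≠ y ∧ adjacent (y : Fin n → Bool) z then 1 / (2 * n) * h z else 0)) z := by
    intro z
    simp only [censoredPmat]
    by_cases hz : (y : Fin n → Bool) = z
    · simp [hz]
    · simp [hz, Ne.symm hz]
  rw [sum_congr rfl fun z _ => e z]
  rw [Finset.sum_coe_sort A (fun z : Fin n → Bool => (if z = y then (1 - ((A.filter fun z => z ≠ (y : Fin n → Bool) ∧ adjacent (y : Fin n → Bool) z).card : ℝ) / (2 * n)) * h y else 0)
      + (if z ≠ y ∧ adjacent (y : Fin n → Bool) z then 1 / (2 * n) * h z else 0))]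
  rw [sum_add_distrib, ← sum_filter, ← sum_filter, sum_nbr A y (fun z => 1 / (2 * n) * h z)]
  have hm : (∑ k, if fl (y : Fin n → Bool) k ∈ A then 1 / (2 * (n:ℝ)) * h (fl y k) else 0)
      = 1 / (2 * n) * ∑ k, if fl (y : Fin n → Bool) k ∈ A then h (fl y k) else 0 := by
    rw [mul_sum]
    apply sum_congr rfl
    intro k _
    split_ifs <;> simp
  rw [hm]
  have hc : ((A.filter fun z => z ≠ (y : Fin n → Bool) ∧ adjacent (y : Fin n → Bool) z).card : ℝ)
      = ∑ k, if fl (y : Fin n → Bool) k ∈ A then (1:ℝ) else 0 := by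
    rw [← sum_nbr A y (fun _ => 1)]; simp
  rw [hc]
  have hq : ∑ k, q A h y k = (∑ k, if fl (y : Fin n → Bool) k ∈ A then (1:ℝ) else 0) * h y
      - ∑ k, if fl (y : Fin n → Bool) k ∈ A then h (fl y k) else 0 := by
    rw [sum_mul, ← sum_sub_distrib]
    apply sum_congr rfl
    intro k _
    simp only [q, y.2, true_and]
    split_ifs <;> simp
  have hf : A.filter (fun z => z = (y : Fin n → Bool)) = {(y : Fin n → Bool)} := by
    ext z; simp only [mem_filter, mem_singleton]
    exact ⟨fun h => h.2, fun h => ⟨h ▸ y.2, h⟩⟩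
  rw [hf, sum_singleton, stp, hq]
  ring

theorem stp_const {n : ℕ} (A : Finset (Fin n → Bool)) (h : (Fin n → Bool) → ℝ) (c : ℝ)
    (x : Fin n → Bool) (hx : x ∈ A) :
    stp A (fun z => if z ∈ A then h z - c else 0) x = stp A h x - c := by
  have : ∀ k, q A (fun z => if z ∈ A then h z - c else 0) x k = q A h x k := by
    intro k
    by_cases h2 : fl x k ∈ A <;> simp [q, hx, h2]
  simp only [stp, this, hx, if_true]
  ring

/-- centered t-step distribution, extended by zero -/
noncomputable def ht {n : ℕ} (A : Finset (Fin n → Bool)) (x0 : {x // x ∈ A}) (t : ℕ)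
    (z : Fin n → Bool) : ℝ :=
  if hz : z ∈ A then (censoredPmat n A ^ t) x0 ⟨z, hz⟩ - 1 / (A.card : ℝ) else 0

theorem ht_succ {n : ℕ} (A : Finset (Fin n → Bool)) (x0 : {x // x ∈ A}) (t : ℕ) :
    ht A x0 (t + 1) = stp A (ht A x0 t) := by
  funext z
  by_cases hz : z ∈ A
  · let g : (Fin n → Bool) → ℝ := fun z => if hz : z ∈ A then (censoredPmat n A ^ t) x0 ⟨z, hz⟩ else 0
    have e : ht A x0 t = fun z => if z ∈ A then g z - 1 / (A.card : ℝ) else 0 := by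
      funext w
      by_cases hw : w ∈ A <;> simp [ht, g, hw]
    rw [e, stp_const A g _ z hz]
    have := P_mul A g ⟨z, hz⟩
    simp only at this
    rw [← this]
    simp only [ht, hz, dif_pos, pow_succ, Matrix.mul_apply]
    congr 1
    apply sum_congr rfl
    intro w _
    rw [P_symm A w, mul_comm]
    simp [g, w.2]
  · rw [stp_supp A _ _ z hz]
    · simp [ht, hz]
    · intro x hx; simp [ht, hx]

theorem sum_ht {n : ℕ} (A : Finset (Fin n → Bool)) (x0 : {x // x ∈ A}) (t : ℕ) (f : ℝ → ℝ) (hf : f 0 = 0) :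
    ∑ x, f (ht A x0 t x) = ∑ y : {x // x ∈ A}, f ((censoredPmat n A ^ t) x0 y - 1 / (A.card : ℝ)) := by
  rw [← sum_subset (subset_univ A) (fun x _ hx => by simp [ht, hx, hf]),
    ← Finset.sum_coe_sort A (fun x => f (ht A x0 t x))]
  apply sum_congr rfl
  intro y _
  simp [ht, y.2]

theorem ht_bound {n : ℕ} (hn : 0 < n) (A : Finset (Fin n → Bool)) (hA : A.Nonempty)
    (hmono : IsMonotoneSet A) (x0 : {x // x ∈ A}) (t : ℕ) :
    ∑ x, ht A x0 t x = 0 ∧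
    ∑ x, ht A x0 t x ^ 2 ≤ (1 - ((A.card : ℝ) / 2 ^ n) ^ 2 / (4 * n ^ 2)) ^ t := by
  have hcard : (0:ℝ) < A.card := by exact_mod_cast hA.card_pos
  have hn1 : (1:ℝ) ≤ n := by exact_mod_cast hn
  have hp1 : (A.card : ℝ) / 2 ^ n ≤ 1 := by
    rw [div_le_one (by positivity)]
    have := card_le_univ A
    simp only [Fintype.card_fun, Fintype.card_bool, Fintype.card_fin] at this
    exact_mod_cast this
  have hp0 : 0 ≤ (A.card : ℝ) / 2 ^ n := by positivity
  have hl : ((A.card : ℝ) / 2 ^ n) ^ 2 / (4 * n ^ 2) ≤ 1 := by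
    rw [div_le_one (by positivity)]
    nlinarith
  induction t with
  | zero =>
    have h1 := sum_ht A x0 0 (fun r => r) rfl
    have h2 := sum_ht A x0 0 (fun r => r ^ 2) (by norm_num)
    simp only [pow_zero, Matrix.one_apply] at h1 h2
    constructor
    · rw [h1]
      simp [sum_sub_distrib, hcard.ne']
    · rw [h2, pow_zero]
      have e : ∀ y : {x // x ∈ A}, ((if x0 = y then (1:ℝ) else 0) - 1 / (A.card : ℝ)) ^ 2
          = (1 - 2 / A.card) * (if x0 = y then (1:ℝ) else 0) + (1 / (A.card : ℝ)) ^ 2 := by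
        intro y; split_ifs <;> ring
      rw [sum_congr rfl fun y _ => e y, sum_add_distrib, ← mul_sum]
      simp only [sum_ite_eq, mem_univ, if_true, sum_const, card_univ, Fintype.card_coe, nsmul_eq_mul]
      have : (A.card : ℝ) * (1 / (A.card : ℝ)) ^ 2 = 1 / A.card := by field_simp
      rw [this]
      have : 0 < 1 / (A.card : ℝ) := by positivity
      have : 2 / (A.card : ℝ) = 2 * (1 / A.card) := by ring
      linarith
  | succ t ih =>
    rw [ht_succ]
    refine ⟨by rw [stp_sum, ih.1], ?_⟩
    have := stp_contract hn A hA hmono (ht A x0 t) (fun x hx => by simp [ht, hx]) ih.1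
    rw [pow_succ']
    exact this.trans (mul_le_mul_of_nonneg_left ih.2 (by linarith))

end Censored

/-- Upper bound on the mixing time of the censored Glauber chain on a nonempty
monotone set `A ⊆ {0,1}^n`: for every `t ≥ 2 (16n/ℙ[A])² log(4 · 2^n ℙ[A])`
and every starting state, the total variation distance to the uniform
distribution on `A` is at most `1/4`. -/
theorem censored_chain_mixing_upper {n : ℕ} (A : Finset (Fin n → Bool))
    (hA : A.Nonempty) (hmono : IsMonotoneSet A) (t : ℕ)
    (ht : (t : ℝ) ≥ 2 * (16 * n / ((A.card : ℝ) / 2 ^ n)) ^ 2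
            * Real.log (4 * 2 ^ n * ((A.card : ℝ) / 2 ^ n)))
    (x0 : {x // x ∈ A}) :
    (1 / 2) * ∑ y : {x // x ∈ A},
        |(censoredPmat n A ^ t) x0 y - 1 / (A.card : ℝ)| ≤ 1 / 4 := by
  rcases Nat.eq_zero_or_pos n with rfl | hn
  · have hs : Subsingleton {x // x ∈ A} := inferInstance
    have hc : A.card = 1 := by
      have h1 := hA.card_pos
      have h2 := Finset.card_le_one_of_subsingleton A
      omega
    have hP : censoredPmat 0 A = 1 := by
      ext x y
      have : x = y := Subsingleton.elim _ _
      subst this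
      simp [censoredPmat]
    rw [hP, one_pow]
    have : ∀ y : {x // x ∈ A}, |(1 : Matrix {x // x ∈ A} {x // x ∈ A} ℝ) x0 y - 1 / (A.card : ℝ)| = 0 := by
      intro y
      have : x0 = y := Subsingleton.elim _ _
      subst this
      simp [hc]
    simp only [this]
    norm_num
  · have hcard : (0:ℝ) < A.card := by exact_mod_cast hA.card_pos
    have hn1 : (0:ℝ) < n := by exact_mod_cast hn
    have hc1 : (1:ℝ) ≤ A.card := by exact_mod_cast hA.card_pos
    have hb := (Censored.ht_bound hn A hA hmono x0 t).2
    have hsq := Censored.sum_ht A x0 t (fun r => r ^ 2) (by norm_num)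
    beta_reduce at hsq
    rw [hsq] at hb
    have hcs := sq_sum_le_card_mul_sum_sq (s := (Finset.univ : Finset {x // x ∈ A}))
      (f := fun y => |(censoredPmat n A ^ t) x0 y - 1 / (A.card : ℝ)|)
    simp only [sq_abs, Finset.card_univ, Fintype.card_coe] at hcs
    have e4 : 4 * 2 ^ n * ((A.card : ℝ) / 2 ^ n) = 4 * A.card := by field_simp
    rw [e4] at ht
    set p := (A.card : ℝ) / 2 ^ n with hp
    have hp0 : 0 < p := by positivity
    have hlog : 0 ≤ Real.log (4 * A.card) := Real.log_nonneg (by linarith)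
    have hlt : Real.log (4 * A.card) ≤ p ^ 2 / (4 * n ^ 2) * t := by
      have h1 := mul_le_mul_of_nonneg_left ht (show (0:ℝ) ≤ p ^ 2 / (4 * n ^ 2) by positivity)
      have h2 : p ^ 2 / (4 * (n:ℝ) ^ 2) * (2 * (16 * n / p) ^ 2 * Real.log (4 * A.card))
          = 128 * Real.log (4 * A.card) := by
        field_simp; ring
      linarith
    have hexp : (1 - p ^ 2 / (4 * (n:ℝ) ^ 2)) ^ t ≤ 1 / (4 * A.card) := by
      have hp1 : p ≤ 1 := by
        rw [hp, div_le_one (by positivity)]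
        have := Finset.card_le_univ A
        simp only [Fintype.card_fun, Fintype.card_bool, Fintype.card_fin] at this
        exact_mod_cast this
      have hn2 : (1:ℝ) ≤ n := by exact_mod_cast hn
      have hl : p ^ 2 / (4 * (n:ℝ) ^ 2) ≤ 1 := by
        rw [div_le_one (by positivity)]; nlinarith
      calc (1 - p ^ 2 / (4 * (n:ℝ) ^ 2)) ^ t ≤ (Real.exp (-(p ^ 2 / (4 * (n:ℝ) ^ 2)))) ^ t :=
            pow_le_pow_left₀ (by linarith) (Real.one_sub_le_exp_neg _) t
        _ = Real.exp (-(p ^ 2 / (4 * (n:ℝ) ^ 2) * t)) := by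
            rw [← Real.exp_nat_mul]; congr 1; ring
        _ ≤ Real.exp (-Real.log (4 * A.card)) := Real.exp_le_exp.2 (by linarith)
        _ = 1 / (4 * A.card) := by
            rw [Real.exp_neg, Real.exp_log (by positivity), one_div]
    have hfin : (∑ y : {x // x ∈ A}, |(censoredPmat n A ^ t) x0 y - 1 / (A.card : ℝ)|) ^ 2
        ≤ (1 / 2) ^ 2 := by
      refine hcs.trans ((mul_le_mul_of_nonneg_left (hb.trans hexp) hcard.le).trans (le_of_eq ?_))
      field_simp; norm_num
    have := abs_le_of_sq_le_sq' hfin (by norm_num)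
    linarith [this.2]
end
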